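/- For each T > 0 there exist positive constants δ, C_1, C_2 such that −C_2|t − s|^{-3/2} Δs Δt ≤ ρ(s, t+Δt) − ρ(s, t) − ρ(s−Δs, t+Δt) + ρ(s−Δs, t) ≤ −C_1|t + Δt − (s − Δs)|^{-3/2} Δs Δt for all 0 ≤ s < t ≤ T, Δs > 0 with s − Δs ≥ 0, and Δt > 0, such that |t − s| < δ, Δs < δ, and Δt < δ. (The middle quantity equals E[(F(s) − F(s−Δs))(F(t+Δt) − F(t))] for any centered Gaussian process F with covariance ρ.) -/

import Mathlib

open MeasureTheory Real Set Filter

/-- The Gaussian heat kernel `p(t,x,y) = (2πt)^{-1/2} exp(-(x-y)²/(2t))`. -/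
noncomputable def heatKernel (t x y : ℝ) : ℝ :=
  (Real.sqrt (2 * Real.pi * t))⁻¹ * Real.exp (-(x - y) ^ 2 / (2 * t))

/-- The density `u(x,t)` of `B(t)`: `f` evolved by the heat semigroup. -/
noncomputable def udens (f : ℝ → ℝ) (x t : ℝ) : ℝ :=
  if t = 0 then f x else ∫ y : ℝ, heatKernel t x y * f y

/-- The covariance function
`ρ(s,t) = (P(B(s) ≤ q(s), B(t) ≤ q(t)) − α²)/(u(q(s),s) u(q(t),t))`. -/
noncomputable def rho {Ω : Type*} [MeasurableSpace Ω] (P : Measure Ω)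
    (B : ℝ → Ω → ℝ) (f : ℝ → ℝ) (q : ℝ → ℝ) (α s t : ℝ) : ℝ :=
  ((P {ω | B s ω ≤ q s ∧ B t ω ≤ q t}).toReal - α ^ 2) /
    (udens f (q s) s * udens f (q t) t)

open scoped Topology NNReal ENNReal

/-- The standard Gaussian measure on the line. -/
noncomputable abbrev stdGauss : Measure ℝ := ProbabilityTheory.gaussianReal 0 1

/-- The standard Gaussian density. -/
noncomputable abbrev stdPhi : ℝ → ℝ := ProbabilityTheory.gaussianPDFReal 0 1

/-- The heat semigroup, `E g(x + √t Z)` with `Z` standard Gaussian. -/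
noncomputable def gaussAvg (g : ℝ → ℝ) (x t : ℝ) : ℝ :=
  ∫ z, g (x + √t * z) ∂stdGauss

lemma stdPhi_eq (z : ℝ) : stdPhi z = (√(2 * π))⁻¹ * Real.exp (-z ^ 2 / 2) := by
  simp [stdPhi, ProbabilityTheory.gaussianPDFReal]

lemma hasDerivAt_stdPhi (z : ℝ) : HasDerivAt stdPhi (-z * stdPhi z) z := by
  have h : HasDerivAt (fun z : ℝ => (√(2 * π))⁻¹ * Real.exp (-z ^ 2 / 2))
      ((√(2 * π))⁻¹ * (Real.exp (-z ^ 2 / 2) * (-(2 * z) / 2))) z := by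
    have h1 : HasDerivAt (fun z : ℝ => -z ^ 2 / 2) (-(2 * z) / 2) z := by
      have := ((hasDerivAt_pow 2 z).neg).div_const 2
      simpa using! this
    exact h1.exp.const_mul _
  rw [funext stdPhi_eq]
  convert h using 1
  ring

lemma integral_stdGauss (h : ℝ → ℝ) : ∫ z, h z ∂stdGauss = ∫ z, h z * stdPhi z := by
  rw [ProbabilityTheory.integral_gaussianReal_eq_integral_smul one_ne_zero]
  simp [mul_comm]

lemma stdGauss_eq_withDensity :
    stdGauss = volume.withDensity (fun z => ENNReal.ofReal (stdPhi z)) := by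
  rw [stdGauss, ProbabilityTheory.gaussianReal_of_var_ne_zero _ one_ne_zero]
  rfl

lemma setIntegral_stdGauss (h : ℝ → ℝ) {S : Set ℝ} (hS : MeasurableSet S) :
    ∫ z in S, h z ∂stdGauss = ∫ z in S, h z * stdPhi z := by
  rw [← integral_indicator hS, integral_stdGauss, ← integral_indicator hS]
  congr 1
  ext z
  by_cases hz : z ∈ S <;> simp [hz]

lemma integrable_stdGauss_iff (h : ℝ → ℝ) :
    Integrable h stdGauss ↔ Integrable (fun z => h z * stdPhi z) := by
  rw [stdGauss_eq_withDensity, integrable_withDensity_iff]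
  · simp only [ENNReal.toReal_ofReal (ProbabilityTheory.gaussianPDFReal_nonneg 0 1 _)]
  · exact (ProbabilityTheory.measurable_gaussianPDFReal 0 1).ennreal_ofReal
  · simp

lemma integrable_id_stdGauss : Integrable (fun z : ℝ => z) stdGauss :=
  (ProbabilityTheory.memLp_id_gaussianReal (μ := 0) (v := 1) 1).integrable (by simp)

lemma tendsto_stdPhi : Tendsto stdPhi (cocompact ℝ) (𝓝 0) := by
  rw [funext stdPhi_eq]
  have := tendsto_rpow_abs_mul_exp_neg_mul_sq_cocompact (a := 1 / 2) (by norm_num) 0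
  have h := this.const_mul (√(2 * π))⁻¹
  simp only [Real.rpow_zero, one_mul, mul_zero] at h
  refine h.congr fun z => ?_
  rw [show -(1 / 2) * z ^ 2 = -z ^ 2 / 2 by ring]

lemma integrable_mul_deriv_stdPhi {h h' : ℝ → ℝ} {M M' : ℝ} (hh : ∀ z, HasDerivAt h (h' z) z)
    (hc : Continuous h') (hM : ∀ z, |h z| ≤ M) (hM' : ∀ z, |h' z| ≤ M') :
    Integrable (fun z => h' z - z * h z) stdGauss := by
  have hcont : Continuous h := continuous_iff_continuousAt.2 fun z => (hh z).continuousAt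
  refine Integrable.sub ?_ ?_
  · exact Integrable.of_bound hc.aestronglyMeasurable M' (ae_of_all _ hM')
  · exact integrable_id_stdGauss.mul_bdd hcont.aestronglyMeasurable (ae_of_all _ hM)

lemma hasDerivAt_mul_stdPhi {h h' : ℝ → ℝ} (hh : ∀ z, HasDerivAt h (h' z) z) (z : ℝ) :
    HasDerivAt (fun z => h z * stdPhi z) ((h' z - z * h z) * stdPhi z) z := by
  refine ((hh z).mul (hasDerivAt_stdPhi z)).congr_deriv ?_
  ring

lemma tendsto_mul_stdPhi {h : ℝ → ℝ} {M : ℝ} (hM : ∀ z, |h z| ≤ M) :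
    Tendsto (fun z => h z * stdPhi z) (cocompact ℝ) (𝓝 0) :=
  bdd_le_mul_tendsto_zero' M (Eventually.of_forall hM) tendsto_stdPhi

lemma stein_Ioi {h h' : ℝ → ℝ} {M M' : ℝ} (hh : ∀ z, HasDerivAt h (h' z) z)
    (hc : Continuous h') (hM : ∀ z, |h z| ≤ M) (hM' : ∀ z, |h' z| ≤ M') (a : ℝ) :
    ∫ z in Ioi a, (h' z - z * h z) ∂stdGauss = -(h a * stdPhi a) := by
  rw [setIntegral_stdGauss _ measurableSet_Ioi,
    integral_Ioi_of_hasDerivAt_of_tendsto' (fun z _ => hasDerivAt_mul_stdPhi hh z)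
    ((integrable_stdGauss_iff _).1 (integrable_mul_deriv_stdPhi hh hc hM hM')).integrableOn
    ((tendsto_mul_stdPhi hM).mono_left atTop_le_cocompact)]
  simp

/-- Stein's identity. -/
lemma stein {h h' : ℝ → ℝ} {M M' : ℝ} (hh : ∀ z, HasDerivAt h (h' z) z)
    (hc : Continuous h') (hM : ∀ z, |h z| ≤ M) (hM' : ∀ z, |h' z| ≤ M') :
    ∫ z, z * h z ∂stdGauss = ∫ z, h' z ∂stdGauss := by
  have hcont : Continuous h := continuous_iff_continuousAt.2 fun z => (hh z).continuousAt
  have h0 : ∫ z, (h' z - z * h z) ∂stdGauss = 0 := by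
    rw [integral_stdGauss, integral_of_hasDerivAt_of_tendsto
      (fun z => hasDerivAt_mul_stdPhi hh z)
      ((integrable_stdGauss_iff _).1 (integrable_mul_deriv_stdPhi hh hc hM hM'))
      ((tendsto_mul_stdPhi hM).mono_left atBot_le_cocompact)
      ((tendsto_mul_stdPhi hM).mono_left atTop_le_cocompact)]
    simp
  rw [integral_sub] at h0
  · linarith
  · exact Integrable.of_bound hc.aestronglyMeasurable M' (ae_of_all _ hM')
  · exact integrable_id_stdGauss.mul_bdd hcont.aestronglyMeasurable (ae_of_all _ hM)

lemma integrable_gaussAvg {g : ℝ → ℝ} {M : ℝ} (hg : Continuous g) (hM : ∀ x, |g x| ≤ M)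
    (x t : ℝ) : Integrable (fun z => g (x + √t * z)) stdGauss :=
  Integrable.of_bound (by fun_prop) M (ae_of_all _ fun _ => hM _)

lemma abs_gaussAvg_le {g : ℝ → ℝ} {M : ℝ} (hM : ∀ x, |g x| ≤ M) (x t : ℝ) :
    |gaussAvg g x t| ≤ M := by
  have := norm_integral_le_of_norm_le_const (μ := stdGauss) (f := fun z => g (x + √t * z))
    (ae_of_all _ fun z => hM (x + √t * z))
  simpa [gaussAvg] using this

lemma gaussAvg_zero (g : ℝ → ℝ) (x : ℝ) : gaussAvg g x 0 = g x := by
  simp [gaussAvg]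

lemma continuous_gaussAvg {g : ℝ → ℝ} {M : ℝ} (hg : Continuous g) (hM : ∀ x, |g x| ≤ M) :
    Continuous (fun p : ℝ × ℝ => gaussAvg g p.1 p.2) := by
  refine continuous_of_dominated (bound := fun _ => M) (fun p => by fun_prop)
    (fun p => ae_of_all _ fun _ => hM _) (integrable_const _) (ae_of_all _ fun z => ?_)
  fun_prop

lemma hasDerivAt_gaussAvg_space {g g' : ℝ → ℝ} {M M' : ℝ} (hg : ∀ x, HasDerivAt g (g' x) x)
    (hg' : Continuous g') (hM : ∀ x, |g x| ≤ M) (hM' : ∀ x, |g' x| ≤ M') (x t : ℝ) :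
    HasDerivAt (fun x => gaussAvg g x t) (gaussAvg g' x t) x := by
  have hcont : Continuous g := continuous_iff_continuousAt.2 fun z => (hg z).continuousAt
  refine (hasDerivAt_integral_of_dominated_loc_of_deriv_le (bound := fun _ => M')
    (F' := fun x z => g' (x + √t * z)) univ_mem
    (Eventually.of_forall fun x => by fun_prop) (integrable_gaussAvg hcont hM x t)
    (by fun_prop) (ae_of_all _ fun z x _ => hM' _) (integrable_const _)
    (ae_of_all _ fun z x _ => ?_)).2
  exact (hg (x + √t * z)).comp_add_const x _

lemma hasDerivAt_gaussAvg_time {g g' g'' : ℝ → ℝ} {M M' M'' : ℝ}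
    (hg : ∀ x, HasDerivAt g (g' x) x) (hg' : ∀ x, HasDerivAt g' (g'' x) x)
    (hg'' : Continuous g'') (hM : ∀ x, |g x| ≤ M) (hM' : ∀ x, |g' x| ≤ M')
    (hM'' : ∀ x, |g'' x| ≤ M'') (x : ℝ) {t : ℝ} (ht : 0 < t) :
    HasDerivAt (fun t => gaussAvg g x t) (1 / 2 * gaussAvg g'' x t) t := by
  have hcont : Continuous g := continuous_iff_continuousAt.2 fun z => (hg z).continuousAt
  have hcont' : Continuous g' := continuous_iff_continuousAt.2 fun z => (hg' z).continuousAt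
  have key := (hasDerivAt_integral_of_dominated_loc_of_deriv_le (μ := stdGauss)
    (F := fun t z => g (x + √t * z)) (x₀ := t) (s := Ioi (t / 2))
    (bound := fun z => M' * (1 / (2 * √(t / 2)) * |z|))
    (F' := fun t z => g' (x + √t * z) * (1 / (2 * √t) * z)) (Ioi_mem_nhds (by linarith))
    (Eventually.of_forall fun x => by fun_prop) (integrable_gaussAvg hcont hM x t)
    (by fun_prop) (ae_of_all _ fun z r hr => ?_)
    ((integrable_id_stdGauss.abs.const_mul _).const_mul _)
    (ae_of_all _ fun z r hr => ?_)).2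
  · refine key.congr_deriv ?_
    have hst := stein (h := fun z => g' (x + √t * z)) (h' := fun z => g'' (x + √t * z) * √t)
      (M := M') (M' := M'' * √t) (fun z => ?_) (by fun_prop) (fun z => hM' _) (fun z => ?_)
    · have h1 : ∫ z, g' (x + √t * z) * (1 / (2 * √t) * z) ∂stdGauss
          = 1 / (2 * √t) * ∫ z, z * g' (x + √t * z) ∂stdGauss := by
        rw [← integral_const_mul]
        congr 1; ext z; ring
      rw [h1, hst, integral_mul_const, gaussAvg]
      have : √t ≠ 0 := (Real.sqrt_pos.2 ht).ne'
      field_simp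
    · refine HasDerivAt.comp z (hg' _) ?_
      simpa using ((hasDerivAt_id z).const_mul (√t)).const_add x
    · rw [abs_mul, abs_of_nonneg (Real.sqrt_nonneg t)]
      exact mul_le_mul_of_nonneg_right (hM'' _) (Real.sqrt_nonneg t)
  · have hr' : t / 2 < r := hr
    have h2 : 0 < √(t / 2) := Real.sqrt_pos.2 (by linarith)
    have h3 : √(t / 2) ≤ √r := Real.sqrt_le_sqrt hr'.le
    rw [Real.norm_eq_abs, abs_mul, abs_mul, abs_of_nonneg (by positivity : 0 ≤ 1 / (2 * √r))]
    have := (abs_nonneg _).trans (hM' 0)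
    gcongr
    exact hM' _
  · have hr' : t / 2 < r := hr
    refine HasDerivAt.comp r (hg _) ?_
    have h0 : r ≠ 0 := by linarith
    exact ((Real.hasDerivAt_sqrt h0).mul_const z).const_add x

lemma hasFDerivAt_gaussAvg {g g' g'' : ℝ → ℝ} {M M' M'' : ℝ}
    (hg : ∀ x, HasDerivAt g (g' x) x) (hg' : ∀ x, HasDerivAt g' (g'' x) x)
    (hg'' : Continuous g'') (hM : ∀ x, |g x| ≤ M) (hM' : ∀ x, |g' x| ≤ M')
    (hM'' : ∀ x, |g'' x| ≤ M'') (x : ℝ) {t : ℝ} (ht : 0 < t) :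
    HasFDerivAt (fun p : ℝ × ℝ => gaussAvg g p.1 p.2)
      ((ContinuousLinearMap.toSpanSingleton ℝ (gaussAvg g' x t)).coprod
        (ContinuousLinearMap.toSpanSingleton ℝ (1 / 2 * gaussAvg g'' x t))) (x, t) := by
  have hcont' : Continuous g' := continuous_iff_continuousAt.2 fun z => (hg' z).continuousAt
  have c1 := continuous_gaussAvg hcont' hM'
  have c2 := continuous_gaussAvg hg'' hM''
  refine (hasStrictFDerivAt_uncurry_coprod (u := (x, t)) (f := gaussAvg g)
    (f₁ := fun x t => ContinuousLinearMap.toSpanSingleton ℝ (gaussAvg g' x t))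
    (f₂ := fun x t => ContinuousLinearMap.toSpanSingleton ℝ (1 / 2 * gaussAvg g'' x t))
    ?_ ?_ ?_ ?_).hasFDerivAt
  · exact Eventually.of_forall fun v =>
      (hasDerivAt_gaussAvg_space hg hcont' hM hM' v.1 v.2).hasFDerivAt
  · have : ∀ᶠ v : ℝ × ℝ in 𝓝 (x, t), 0 < v.2 :=
      continuous_snd.continuousAt.eventually (lt_mem_nhds ht)
    exact this.mono fun v hv =>
      (hasDerivAt_gaussAvg_time hg hg' hg'' hM hM' hM'' v.1 hv).hasFDerivAt
  · exact ((ContinuousLinearMap.toSpanSingletonCLE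
      (𝕜 := ℝ) (E := ℝ)).continuous.comp c1).continuousAt
  · exact ((ContinuousLinearMap.toSpanSingletonCLE (𝕜 := ℝ) (E := ℝ)).continuous.comp
      (c2.const_mul _)).continuousAt

/-- The derivative of the heat flow along a moving point. -/
lemma HasDerivAt.gaussAvg_comp {g g' g'' : ℝ → ℝ} {M M' M'' : ℝ}
    (hg : ∀ x, HasDerivAt g (g' x) x) (hg' : ∀ x, HasDerivAt g' (g'' x) x)
    (hg'' : Continuous g'') (hM : ∀ x, |g x| ≤ M) (hM' : ∀ x, |g' x| ≤ M')
    (hM'' : ∀ x, |g'' x| ≤ M'') {a : ℝ → ℝ} {a' t : ℝ} (ha : HasDerivAt a a' t) (ht : 0 < t) :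
    HasDerivAt (fun t => gaussAvg g (a t) t)
      (a' * gaussAvg g' (a t) t + 1 / 2 * gaussAvg g'' (a t) t) t := by
  have h := HasFDerivAt.comp_hasDerivAt (f := fun t => (a t, t)) t
    (hasFDerivAt_gaussAvg hg hg' hg'' hM hM' hM'' (a t) ht) (ha.prodMk (hasDerivAt_id t))
  refine h.congr_deriv ?_
  simp

lemma gaussianReal_eq_map_stdGauss (x : ℝ) {t : ℝ} (ht : 0 ≤ t) :
    ProbabilityTheory.gaussianReal x t.toNNReal = stdGauss.map (fun z => x + √t * z) := by
  have h : (fun z : ℝ => x + √t * z) = (fun z => x + z) ∘ (fun z => √t * z) := rfl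
  rw [h, ← Measure.map_map (by fun_prop) (by fun_prop), stdGauss,
    ProbabilityTheory.gaussianReal_map_const_mul, ProbabilityTheory.gaussianReal_map_const_add]
  congr 1
  · simp
  · ext
    simp [Real.sq_sqrt ht, ht]

lemma heatKernel_eq_gaussianPDFReal {t : ℝ} (ht : 0 ≤ t) (x y : ℝ) :
    heatKernel t x y = ProbabilityTheory.gaussianPDFReal x t.toNNReal y := by
  rw [heatKernel, ProbabilityTheory.gaussianPDFReal, Real.coe_toNNReal t ht,
    show (x - y) ^ 2 = (y - x) ^ 2 by ring]

lemma integral_heatKernel_mul {g : ℝ → ℝ} (hg : Measurable g) (x : ℝ) {t : ℝ} (ht : 0 < t) :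
    ∫ y, heatKernel t x y * g y = gaussAvg g x t := by
  have h0 : t.toNNReal ≠ 0 := by simpa using ht
  rw [gaussAvg, ← integral_map (f := g) (φ := fun z => x + √t * z) (by fun_prop)
    hg.aestronglyMeasurable, ← gaussianReal_eq_map_stdGauss x ht.le,
    ProbabilityTheory.integral_gaussianReal_eq_integral_smul h0]
  simp [heatKernel_eq_gaussianPDFReal ht.le]

lemma udens_eq_gaussAvg {f : ℝ → ℝ} (hf : Continuous f) (x : ℝ) {t : ℝ} (ht : 0 ≤ t) :
    udens f x t = gaussAvg f x t := by
  rcases ht.eq_or_lt with rfl | ht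
  · simp [udens, gaussAvg_zero]
  · rw [udens, if_neg ht.ne', integral_heatKernel_mul hf.measurable x ht]

lemma integrable_prod_shift {f : ℝ → ℝ} (hc : Continuous f) (hf : Integrable f) (t : ℝ) :
    Integrable (fun p : ℝ × ℝ => f (p.1 + √t * p.2)) (volume.prod stdGauss) := by
  rw [integrable_prod_iff' (by fun_prop)]
  refine ⟨ae_of_all _ fun z => hf.comp_add_right (√t * z), ?_⟩
  have : (fun z : ℝ => ∫ x, ‖f (x + √t * z)‖) = fun _ => ∫ x, ‖f x‖ := by
    ext z
    exact integral_add_right_eq_self (fun x => ‖f x‖) _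
  rw [this]
  exact integrable_const _

lemma integrable_gaussAvg_space {f : ℝ → ℝ} (hc : Continuous f) (hf : Integrable f) (t : ℝ) :
    Integrable (fun x => gaussAvg f x t) :=
  (integrable_prod_shift hc hf t).integral_prod_left

lemma setIntegral_Iic_gaussAvg {f : ℝ → ℝ} (hc : Continuous f) (hf : Integrable f) (a t : ℝ) :
    ∫ x in Iic a, gaussAvg f x t = gaussAvg (fun x => ∫ y in Iic x, f y) a t := by
  simp only [gaussAvg]
  rw [integral_integral_swap (f := fun x z => f (x + √t * z))]
  · congr 1
    ext z
    rw [← integral_indicator measurableSet_Iic, ← integral_indicator measurableSet_Iic,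
      ← integral_add_right_eq_self ((Iic (a + √t * z)).indicator f) (√t * z)]
    congr 1
    ext x
    simp [indicator]
  · rw [← Measure.restrict_univ (μ := stdGauss), Measure.prod_restrict]
    exact (integrable_prod_shift hc hf t).integrableOn

lemma setIntegral_heatKernel_mul {u : ℝ → ℝ} (hu : Integrable u) {τ : ℝ} (hτ : 0 < τ) (a b : ℝ) :
    ∫ x in Iic a, (∫ y in Iic b, heatKernel τ x y) * u x
      = ∫ z, (∫ x in Iic (min a (b - √τ * z)), u x) ∂stdGauss := by
  have h1 : ∀ x, ∫ y in Iic b, heatKernel τ x y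
      = ∫ z, (Iic b).indicator (fun _ => (1 : ℝ)) (x + √τ * z) ∂stdGauss := by
    intro x
    have := integral_heatKernel_mul (g := (Iic b).indicator (fun _ => (1 : ℝ)))
      (measurable_const.indicator measurableSet_Iic) x hτ
    rw [gaussAvg] at this
    rw [← this, ← integral_indicator measurableSet_Iic]
    congr 1
    ext y
    simp [indicator]
  have hm : Measurable fun p : ℝ × ℝ =>
      (Iic b).indicator (fun _ => (1 : ℝ)) (p.1 + √τ * p.2) :=
    (measurable_const.indicator measurableSet_Iic).comp (by fun_prop)
  simp_rw [h1, ← integral_mul_const]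
  rw [integral_integral_swap
    (f := fun x z => (Iic b).indicator (fun _ => (1 : ℝ)) (x + √τ * z) * u x)]
  · congr 1
    ext z
    rw [← integral_indicator measurableSet_Iic, ← integral_indicator measurableSet_Iic]
    congr 1
    ext x
    by_cases h2 : x ≤ a <;> simp [indicator, le_sub_iff_add_le, h2]
  · refine Integrable.bdd_mul (c := 1) ?_ hm.aestronglyMeasurable (ae_of_all _ fun p => ?_)
    · exact hu.integrableOn.comp_fst _
    · exact (norm_indicator_le_norm_self _ _).trans (by simp)

/-- A bounded profile `F` with bounded derivatives `f ≥ 0`, `f'`, `f''`, together with the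
level curve `q` on which the heat flow of `F` takes the value `α`. -/
structure HeatLevelCurve (F f f' f'' q : ℝ → ℝ) (α M : ℝ) : Prop where
  deriv_F : ∀ x, HasDerivAt F (f x) x
  deriv_f : ∀ x, HasDerivAt f (f' x) x
  deriv_f' : ∀ x, HasDerivAt f' (f'' x) x
  cont_f'' : Continuous f''
  nonneg : ∀ x, 0 ≤ f x
  bound_F : ∀ x, |F x| ≤ 1
  bound_f : ∀ x, |f x| ≤ M
  bound_f' : ∀ x, |f' x| ≤ M
  bound_f'' : ∀ x, |f'' x| ≤ M
  level : ∀ t, 0 ≤ t → gaussAvg F (q t) t = α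
  unique : ∀ t, 0 ≤ t → ∀ r, gaussAvg F r t = α → r = q t
  pos : ∀ t, 0 ≤ t → 0 < gaussAvg f (q t) t

namespace HeatLevelCurve

variable {F f f' f'' q : ℝ → ℝ} {α M : ℝ}

lemma cont_F (H : HeatLevelCurve F f f' f'' q α M) : Continuous F :=
  continuous_iff_continuousAt.2 fun z => (H.deriv_F z).continuousAt

lemma cont_f (H : HeatLevelCurve F f f' f'' q α M) : Continuous f :=
  continuous_iff_continuousAt.2 fun z => (H.deriv_f z).continuousAt

lemma cont_f' (H : HeatLevelCurve F f f' f'' q α M) : Continuous f' :=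
  continuous_iff_continuousAt.2 fun z => (H.deriv_f' z).continuousAt

lemma M_nonneg (H : HeatLevelCurve F f f' f'' q α M) : 0 ≤ M :=
  (abs_nonneg _).trans (H.bound_f 0)

lemma monotone (H : HeatLevelCurve F f f' f'' q α M) (t : ℝ) :
    Monotone (fun x => gaussAvg F x t) := by
  have hF : Monotone F := monotone_of_hasDerivAt_nonneg H.deriv_F H.nonneg
  intro x y hxy
  exact integral_mono (integrable_gaussAvg H.cont_F H.bound_F x t)
    (integrable_gaussAvg H.cont_F H.bound_F y t) fun z => hF (by linarith)

lemma continuousOn_q (H : HeatLevelCurve F f f' f'' q α M) : ContinuousOn q (Ici 0) := by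
  intro t ht
  have hcont : ∀ c, Continuous fun t => gaussAvg F c t := fun c =>
    (continuous_gaussAvg H.cont_F H.bound_F).comp (by fun_prop : Continuous fun t : ℝ => (c, t))
  refine tendsto_order.2 ⟨fun c hc => ?_, fun c hc => ?_⟩
  · have h1 : gaussAvg F c t < α := by
      refine lt_of_le_of_ne ((H.monotone t hc.le).trans_eq (H.level t ht)) fun h => ?_
      exact hc.ne (H.unique t ht c h)
    filter_upwards [self_mem_nhdsWithin, nhdsWithin_le_nhds
      ((hcont c).continuousAt.eventually (gt_mem_nhds h1))] with r hr hlt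
    by_contra! hle
    exact absurd (H.monotone r hle) (by simpa [H.level r hr] using hlt)
  · have h1 : α < gaussAvg F c t := by
      refine lt_of_le_of_ne ((H.level t ht).symm.trans_le (H.monotone t hc.le)) fun h => ?_
      exact hc.ne' (H.unique t ht c h.symm)
    filter_upwards [self_mem_nhdsWithin, nhdsWithin_le_nhds
      ((hcont c).continuousAt.eventually (lt_mem_nhds h1))] with r hr hlt
    by_contra! hle
    exact absurd (H.monotone r hle) (by simpa [H.level r hr] using hlt)

lemma hasDerivAt_q (H : HeatLevelCurve F f f' f'' q α M) {t : ℝ} (ht : 0 < t) :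
    HasDerivAt q (-(gaussAvg f' (q t) t) / (2 * gaussAvg f (q t) t)) t := by
  have hcq : ContinuousAt q t := H.continuousOn_q.continuousAt (Ici_mem_nhds ht)
  have hu := H.pos t ht.le
  have hF := (hasFDerivAt_gaussAvg H.deriv_F H.deriv_f H.cont_f' H.bound_F H.bound_f H.bound_f'
    (q t) ht).prodMk (hasFDerivAt_snd (𝕜 := ℝ) (E := ℝ) (F := ℝ) (p := (q t, t)))
  have hh := (hasFDerivAt_const (𝕜 := ℝ) α t).prodMk (hasFDerivAt_id (𝕜 := ℝ) t)
  have key := HasFDerivAt.of_comp_of_leftInverse (g := fun t => (q t, t))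
    (f'symm := (((gaussAvg f (q t) t)⁻¹ • (ContinuousLinearMap.fst ℝ ℝ ℝ
      - (1 / 2 * gaussAvg f' (q t) t) • ContinuousLinearMap.snd ℝ ℝ ℝ)).prod
        (ContinuousLinearMap.snd ℝ ℝ ℝ)))
    (hcq.prodMk continuousAt_id) hF hh ?_ ?_
  · have h1 : HasDerivAt q _ t := (HasFDerivAt.fst key).hasDerivAt
    refine h1.congr_deriv ?_
    simp
    field_simp
  · filter_upwards [lt_mem_nhds ht] with r hr
    simp [H.level r hr.le]
  · intro p
    ext
    · simp
      field_simp
      ring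
    · simp

lemma hasDerivAt_density (H : HeatLevelCurve F f f' f'' q α M) {t : ℝ} (ht : 0 < t) :
    HasDerivAt (fun t => gaussAvg f (q t) t)
      (-(gaussAvg f' (q t) t) / (2 * gaussAvg f (q t) t) * gaussAvg f' (q t) t
        + 1 / 2 * gaussAvg f'' (q t) t) t :=
  (H.hasDerivAt_q ht).gaussAvg_comp H.deriv_f H.deriv_f' H.cont_f'' H.bound_f H.bound_f'
    H.bound_f'' ht

lemma continuousOn_density (H : HeatLevelCurve F f f' f'' q α M) :
    ContinuousOn (fun t => gaussAvg f (q t) t) (Ici 0) :=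
  (continuous_gaussAvg H.cont_f H.bound_f).comp_continuousOn
    (H.continuousOn_q.prodMk continuousOn_id)

lemma exists_density_lower_bound (H : HeatLevelCurve F f f' f'' q α M) (T : ℝ) :
    ∃ m > 0, ∀ t ∈ Icc 0 T, m ≤ gaussAvg f (q t) t := by
  rcases (Icc 0 T).eq_empty_or_nonempty with h | h
  · exact ⟨1, one_pos, by simp [h]⟩
  · obtain ⟨t, ht, hmin⟩ := isCompact_Icc.exists_isMinOn h
      (H.continuousOn_density.mono fun t ht => ht.1)
    exact ⟨_, H.pos t ht.1, fun r hr => hmin hr⟩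

lemma gaussAvg_lipschitz_space (H : HeatLevelCurve F f f' f'' q α M) (x y t : ℝ) :
    |gaussAvg F x t - gaussAvg F y t| ≤ M * |x - y| := by
  have := Convex.norm_image_sub_le_of_norm_hasDerivWithin_le (s := univ)
    (f := fun x => gaussAvg F x t) (f' := fun x => gaussAvg f x t) (C := M)
    (fun x _ => (hasDerivAt_gaussAvg_space H.deriv_F H.cont_f H.bound_F H.bound_f x
      t).hasDerivWithinAt) (fun x _ => abs_gaussAvg_le H.bound_f x t) convex_univ
    (mem_univ y) (mem_univ x)
  simpa using this

lemma gaussAvg_lipschitz_time (H : HeatLevelCurve F f f' f'' q α M) (x : ℝ) {s t : ℝ}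
    (hs : 0 < s) (ht : 0 < t) : |gaussAvg F x s - gaussAvg F x t| ≤ M * |s - t| := by
  have := Convex.norm_image_sub_le_of_norm_hasDerivWithin_le (s := Ioi 0)
    (f := fun t => gaussAvg F x t) (f' := fun t => 1 / 2 * gaussAvg f' x t) (C := M)
    (fun t ht => (hasDerivAt_gaussAvg_time H.deriv_F H.deriv_f H.cont_f' H.bound_F H.bound_f
      H.bound_f' x ht).hasDerivWithinAt) (fun t _ => ?_) (convex_Ioi 0) (mem_Ioi.2 ht)
    (mem_Ioi.2 hs)
  · simpa using this
  · have := abs_gaussAvg_le H.bound_f' x t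
    rw [Real.norm_eq_abs, abs_mul, abs_of_pos (by norm_num : (0 : ℝ) < 1 / 2)]
    linarith [H.M_nonneg]

lemma lipschitz_q (H : HeatLevelCurve F f f' f'' q α M) {T m : ℝ} (hm : 0 < m)
    (hD : ∀ t ∈ Icc 0 T, m ≤ gaussAvg f (q t) t) {s t : ℝ} (hs : s ∈ Icc 0 T)
    (ht : t ∈ Icc 0 T) : |q t - q s| ≤ M / (2 * m) * |t - s| := by
  wlog hst : s ≤ t generalizing s t
  · rw [abs_sub_comm, abs_sub_comm t]
    exact this ht hs (le_of_not_ge hst)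
  rcases hst.eq_or_lt with rfl | hst
  · simp
  obtain ⟨c, hc, hc'⟩ := exists_hasDerivAt_eq_slope q _ hst
    (H.continuousOn_q.mono fun r hr => hs.1.trans hr.1)
    (fun r hr => H.hasDerivAt_q (hs.1.trans_lt hr.1))
  have hcD := hD c ⟨hs.1.trans hc.1.le, hc.2.le.trans ht.2⟩
  rw [eq_div_iff (by linarith)] at hc'
  rw [← hc', abs_mul, abs_div, abs_neg, abs_of_pos (a := 2 * _) (by linarith)]
  have := abs_gaussAvg_le H.bound_f' (q c) c
  have := H.M_nonneg
  gcongr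

end HeatLevelCurve

/-- The probability that a Brownian motion whose law at time `s` has distribution function
`gaussAvg F · s` lies below the curve `q` at both times `s` and `t`. -/
noncomputable def jointLevel (F q : ℝ → ℝ) (s t : ℝ) : ℝ :=
  ∫ z, gaussAvg F (min (q s) (q t - √(t - s) * z)) s ∂stdGauss

namespace HeatLevelCurve

variable {F f f' f'' q : ℝ → ℝ} {α M : ℝ}

lemma abs_jointLevel_le (H : HeatLevelCurve F f f' f'' q α M) (s t : ℝ) :
    |jointLevel F q s t| ≤ 1 := by
  have := norm_integral_le_of_norm_le_const (μ := stdGauss)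
    (f := fun z => gaussAvg F (min (q s) (q t - √(t - s) * z)) s)
    (ae_of_all _ fun z => abs_gaussAvg_le H.bound_F _ _)
  simpa [jointLevel] using this

lemma continuous_jointLevel_integrand (H : HeatLevelCurve F f f' f'' q α M) (s t : ℝ) :
    Continuous fun z => gaussAvg F (min (q s) (q t - √(t - s) * z)) s :=
  (continuous_gaussAvg H.cont_F H.bound_F).comp
    (by fun_prop : Continuous fun z => (min (q s) (q t - √(t - s) * z), s))

lemma integrable_jointLevel_integrand (H : HeatLevelCurve F f f' f'' q α M) (s t : ℝ) :
    Integrable (fun z => gaussAvg F (min (q s) (q t - √(t - s) * z)) s) stdGauss :=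
  Integrable.of_bound (H.continuous_jointLevel_integrand s t).aestronglyMeasurable 1
    (ae_of_all _ fun _ => abs_gaussAvg_le H.bound_F _ _)

lemma continuousOn_jointLevel (H : HeatLevelCurve F f f' f'' q α M) (t : ℝ) :
    ContinuousOn (fun s => jointLevel F q s t) (Ici 0) := by
  refine continuousOn_of_dominated (bound := fun _ => 1)
    (fun s _ => (H.continuous_jointLevel_integrand s t).aestronglyMeasurable)
    (fun s _ => ae_of_all _ fun _ => abs_gaussAvg_le H.bound_F _ _) (integrable_const _)
    (ae_of_all _ fun z => ?_)
  refine (continuous_gaussAvg H.cont_F H.bound_F).comp_continuousOn (ContinuousOn.prodMk ?_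
    continuousOn_id)
  exact H.continuousOn_q.inf (by fun_prop)

/-- The modulus of continuity in the later time variable. -/
lemma abs_jointLevel_sub_le (H : HeatLevelCurve F f f' f'' q α M) {s t t' : ℝ} (htt' : t ≤ t') :
    |jointLevel F q s t' - jointLevel F q s t|
      ≤ M * (|q t' - q t| + (√(t' - s) - √(t - s)) * ∫ z, |z| ∂stdGauss) := by
  have hsq : √(t - s) ≤ √(t' - s) := Real.sqrt_le_sqrt (by linarith)
  rw [jointLevel, jointLevel, ← integral_sub (H.integrable_jointLevel_integrand s t')
    (H.integrable_jointLevel_integrand s t)]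
  have hi : Integrable (fun z => M * (|q t' - q t| + (√(t' - s) - √(t - s)) * |z|)) stdGauss :=
    ((integrable_const _).add (integrable_id_stdGauss.abs.const_mul _)).const_mul _
  refine (norm_integral_le_of_norm_le (f := fun z =>
    gaussAvg F (min (q s) (q t' - √(t' - s) * z)) s
      - gaussAvg F (min (q s) (q t - √(t - s) * z)) s) hi (ae_of_all _ fun z => ?_)).trans_eq ?_
  · refine (H.gaussAvg_lipschitz_space _ _ _).trans ?_
    refine mul_le_mul_of_nonneg_left ?_ H.M_nonneg
    have h1 := abs_min_sub_min_le_max (q s) (q t' - √(t' - s) * z) (q s) (q t - √(t - s) * z)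
    rw [sub_self, abs_zero, max_eq_right (abs_nonneg _)] at h1
    refine h1.trans ?_
    rw [show q t' - √(t' - s) * z - (q t - √(t - s) * z)
      = (q t' - q t) - (√(t' - s) - √(t - s)) * z by ring]
    refine (abs_sub _ _).trans_eq ?_
    rw [abs_mul (√(t' - s) - √(t - s)), abs_of_nonneg (sub_nonneg.2 hsq)]
  · rw [integral_const_mul, integral_add (integrable_const _)
      (integrable_id_stdGauss.abs.const_mul _), integral_const_mul]
    simp

lemma abs_sqrt_sub_sqrt_le {a b c : ℝ} (hc : 0 < c) (ha : c ≤ a) (hb : c ≤ b) :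
    |√a - √b| ≤ 1 / √c * |a - b| := by
  have h0 : 0 < √c := Real.sqrt_pos.2 hc
  have h1 : √c ≤ √a := Real.sqrt_le_sqrt ha
  have h2 : 0 ≤ √b := Real.sqrt_nonneg b
  have h3 : a - b = (√a - √b) * (√a + √b) := by
    have ea := Real.sq_sqrt (hc.le.trans ha)
    have eb := Real.sq_sqrt (hc.le.trans hb)
    nlinarith
  rw [h3, abs_mul, abs_of_pos (by linarith : 0 < √a + √b), one_div, inv_mul_eq_div,
    le_div_iff₀ h0]
  exact mul_le_mul_of_nonneg_left (by linarith) (abs_nonneg _)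

lemma lipschitz_jointLevel_integrand (H : HeatLevelCurve F f f' f'' q α M) {L c t z s s' : ℝ}
    (hc : 0 < c) (hs : 0 < s) (hs' : 0 < s') (hts : c ≤ t - s) (hts' : c ≤ t - s')
    (hL : |q s - q s'| ≤ L * |s - s'|) :
    |gaussAvg F (min (q s) (q t - √(t - s) * z)) s
      - gaussAvg F (min (q s') (q t - √(t - s') * z)) s'|
      ≤ (M * (L + 1 / √c * |z|) + M) * |s - s'| := by
  have h1 := H.gaussAvg_lipschitz_space (min (q s) (q t - √(t - s) * z))
    (min (q s') (q t - √(t - s') * z)) s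
  have h2 := H.gaussAvg_lipschitz_time (min (q s') (q t - √(t - s') * z)) hs hs'
  have h3 := abs_min_sub_min_le_max (q s) (q t - √(t - s) * z) (q s') (q t - √(t - s') * z)
  have h4 := abs_sqrt_sub_sqrt_le hc hts hts'
  have h5 : |q t - √(t - s) * z - (q t - √(t - s') * z)| ≤ 1 / √c * |z| * |s - s'| := by
    rw [show q t - √(t - s) * z - (q t - √(t - s') * z)
      = -((√(t - s) - √(t - s')) * z) by ring, abs_neg, abs_mul]
    rw [show t - s - (t - s') = -(s - s') by ring, abs_neg] at h4
    calc _ ≤ 1 / √c * |s - s'| * |z| := mul_le_mul_of_nonneg_right h4 (abs_nonneg z)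
      _ = _ := by ring
  have h6 : |min (q s) (q t - √(t - s) * z) - min (q s') (q t - √(t - s') * z)|
      ≤ (L + 1 / √c * |z|) * |s - s'| := by
    refine h3.trans (max_le (hL.trans ?_) (h5.trans ?_))
    · have : 0 ≤ 1 / √c * |z| * |s - s'| := by positivity
      linarith
    · have := (abs_nonneg _).trans hL
      linarith
  calc _ ≤ _ := abs_sub_le _ (gaussAvg F (min (q s') (q t - √(t - s') * z)) s) _
    _ ≤ M * ((L + 1 / √c * |z|) * |s - s'|) + M * |s - s'| :=
      add_le_add (h1.trans (mul_le_mul_of_nonneg_left h6 H.M_nonneg)) h2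
    _ = _ := by ring

/-- Away from the kink, the integrand of `jointLevel` is differentiable in the earlier time. -/
lemma hasDerivAt_jointLevel_integrand (H : HeatLevelCurve F f f' f'' q α M) {s t z : ℝ}
    (hs : 0 < s) (hst : s < t) (hz : z ≠ (q t - q s) / √(t - s)) :
    HasDerivAt (fun s => gaussAvg F (min (q s) (q t - √(t - s) * z)) s)
      ((Ioi ((q t - q s) / √(t - s))).indicator (fun z => -(1 / (2 * √(t - s))) *
        (-√(t - s) * gaussAvg f' (q t - √(t - s) * z) s
          - z * gaussAvg f (q t - √(t - s) * z) s)) z) s := by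
  have hτ : 0 < √(t - s) := Real.sqrt_pos.2 (by linarith)
  have hcq : ContinuousAt q s := H.continuousOn_q.continuousAt (Ici_mem_nhds hs)
  have hcb : ContinuousAt (fun s => q t - √(t - s) * z) s := by fun_prop
  rcases lt_or_gt_of_ne hz with hz | hz
  · rw [indicator_of_notMem (by simpa using hz.le)]
    rw [lt_div_iff₀ hτ] at hz
    refine (hasDerivAt_const s α).congr_of_eventuallyEq ?_
    filter_upwards [hcq.eventually_lt hcb (by linarith), lt_mem_nhds hs] with r hr hr0
    rw [min_eq_left hr.le, H.level r hr0.le]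
  · rw [indicator_of_mem (mem_Ioi.2 hz)]
    rw [div_lt_iff₀ hτ] at hz
    have hb : HasDerivAt (fun s => q t - √(t - s) * z) (1 / (2 * √(t - s)) * z) s := by
      have h1 : HasDerivAt (fun s => √(t - s)) (-1 / (2 * √(t - s))) s :=
        ((hasDerivAt_id s).const_sub t).sqrt (by simp; linarith)
      refine ((h1.mul_const z).const_sub (q t)).congr_deriv ?_
      ring
    refine HasDerivAt.congr_of_eventuallyEq (f := fun s => gaussAvg F (q t - √(t - s) * z) s)
      ?_ ?_
    · refine (hb.gaussAvg_comp H.deriv_F H.deriv_f H.cont_f' H.bound_F H.bound_f H.bound_f'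
        hs).congr_deriv ?_
      field_simp
      ring
    · filter_upwards [hcb.eventually_lt hcq (by linarith)] with r hr
      rw [min_eq_right hr.le]

lemma hasDerivAt_jointLevel (H : HeatLevelCurve F f f' f'' q α M) {s t : ℝ}
    (hs : 0 < s) (hst : s < t) :
    HasDerivAt (fun s => jointLevel F q s t)
      (1 / 2 * gaussAvg f (q s) s * (1 / √(t - s) * stdPhi ((q t - q s) / √(t - s)))) s := by
  have hτ : 0 < √(t - s) := Real.sqrt_pos.2 (by linarith)
  obtain ⟨m, hm, hD⟩ := H.exists_density_lower_bound t
  have hcf : ∀ {g : ℝ → ℝ}, Continuous g → (∀ x, |g x| ≤ M) →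
      Continuous fun z => gaussAvg g (q t - √(t - s) * z) s := fun hg hM =>
    (continuous_gaussAvg hg hM).comp
      (by fun_prop : Continuous fun z => (q t - √(t - s) * z, s))
  have hc1 := hcf H.cont_f H.bound_f
  have hc2 := hcf H.cont_f' H.bound_f'
  have key := (hasDerivAt_integral_of_dominated_loc_of_lip (μ := stdGauss) (x₀ := s)
    (F := fun s z => gaussAvg F (min (q s) (q t - √(t - s) * z)) s)
    (s := Ioo 0 ((s + t) / 2))
    (bound := fun z => M * (M / (2 * m) + 1 / √((t - s) / 2) * |z|) + M)
    (F' := fun z => (Ioi ((q t - q s) / √(t - s))).indicator (fun z => -(1 / (2 * √(t - s))) *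
        (-√(t - s) * gaussAvg f' (q t - √(t - s) * z) s
          - z * gaussAvg f (q t - √(t - s) * z) s)) z)
    (Ioo_mem_nhds hs (by linarith))
    (Eventually.of_forall fun r => (H.continuous_jointLevel_integrand r t).aestronglyMeasurable)
    (H.integrable_jointLevel_integrand s t) ?_ ?_ ?_ ?_).2
  · refine key.congr_deriv ?_
    rw [integral_indicator measurableSet_Ioi, integral_const_mul,
      stein_Ioi (h := fun z => gaussAvg f (q t - √(t - s) * z) s)
      (h' := fun z => -√(t - s) * gaussAvg f' (q t - √(t - s) * z) s) (M := M)
      (M' := √(t - s) * M) ?_ (continuous_const.mul hc2)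
      (fun z => abs_gaussAvg_le H.bound_f _ _) ?_]
    · rw [mul_div_cancel₀ _ hτ.ne', sub_sub_cancel]
      ring
    · intro z
      have h1 : HasDerivAt (fun z => q t - √(t - s) * z) (-√(t - s)) z := by
        simpa using ((hasDerivAt_id z).const_mul (√(t - s))).const_sub (q t)
      have := (hasDerivAt_gaussAvg_space H.deriv_f H.cont_f' H.bound_f H.bound_f'
        (q t - √(t - s) * z) s).comp z h1
      exact this.congr_deriv (by ring)
    · intro z
      rw [abs_mul, abs_neg, abs_of_pos hτ]
      exact mul_le_mul_of_nonneg_left (abs_gaussAvg_le H.bound_f' _ _) hτ.le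
  · refine Measurable.aestronglyMeasurable (Measurable.indicator ?_ measurableSet_Ioi)
    exact (continuous_const.mul ((continuous_const.mul hc2).sub
      (continuous_id.mul hc1))).measurable
  · refine ae_of_all _ fun z => LipschitzOnWith.of_dist_le_mul fun x hx y hy => ?_
    have := H.M_nonneg
    rw [Real.dist_eq, Real.dist_eq, Real.coe_nnabs, abs_of_nonneg (a := M * _ + M) (by positivity)]
    exact H.lipschitz_jointLevel_integrand (c := (t - s) / 2) (by linarith) hx.1 hy.1
      (by linarith [hx.2]) (by linarith [hy.2]) (H.lipschitz_q hm hD ⟨hy.1.le, by linarith [hy.2]⟩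
        ⟨hx.1.le, by linarith [hx.2]⟩)
  · exact (((integrable_const _).add (integrable_id_stdGauss.abs.const_mul _)).const_mul _).add
      (integrable_const _)
  · have hne : ∀ᵐ z ∂stdGauss, z ≠ (q t - q s) / √(t - s) := by
      have := ProbabilityTheory.nullSingletonClass_gaussianReal (μ := 0) (v := 1) one_ne_zero
      exact Measure.ae_ne _ _
    filter_upwards [hne] with z hz
    exact H.hasDerivAt_jointLevel_integrand hs hst hz

end HeatLevelCurve

lemma stdPhi_le (z : ℝ) : stdPhi z ≤ (√(2 * π))⁻¹ := by
  rw [stdPhi_eq]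
  refine mul_le_of_le_one_right (by positivity) (Real.exp_le_one_iff.2 ?_)
  nlinarith [sq_nonneg z]

lemma inv_sqrt_two_pi_le_one : (√(2 * π))⁻¹ ≤ 1 := by
  refine inv_le_one_of_one_le₀ (Real.one_le_sqrt.2 ?_)
  linarith [Real.two_le_pi]

/-- The logarithmic derivative of the heat kernel along a curve. -/
lemma hasDerivAt_kernel {y : ℝ → ℝ} {y' ξ r : ℝ} (hr : ξ < r) (hy : HasDerivAt y y' r) :
    HasDerivAt (fun r => 1 / √(r - ξ) * stdPhi (y r / √(r - ξ)))
      (1 / √(r - ξ) * stdPhi (y r / √(r - ξ)) *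
        (-1 / (2 * (r - ξ)) - y r * y' / (r - ξ) + (y r) ^ 2 / (2 * (r - ξ) ^ 2))) r := by
  have hτ : 0 < r - ξ := sub_pos.2 hr
  have hs : 0 < √(r - ξ) := Real.sqrt_pos.2 hτ
  have hsq : √(r - ξ) ^ 2 = r - ξ := Real.sq_sqrt hτ.le
  have h1 : HasDerivAt (fun r => √(r - ξ)) (1 / (2 * √(r - ξ))) r :=
    ((hasDerivAt_id r).sub_const ξ).sqrt hτ.ne'
  have h2 := (hasDerivAt_const r (1 : ℝ)).div h1 hs.ne'
  have h3 := (hasDerivAt_stdPhi (y r / √(r - ξ))).comp r (hy.div h1 hs.ne')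
  refine (h2.mul h3).congr_deriv ?_
  simp only [Function.comp, Pi.div_apply]
  rw [← hsq]
  simp only [Real.sqrt_sq hs.le]
  field_simp
  ring

lemma kernel_bounds {L ξ r y y' : ℝ} (hr : ξ < r) (hy : |y| ≤ L * (r - ξ))
    (hy' : |y'| ≤ L) (hsmall : 8 * L ^ 2 * (r - ξ) ≤ 1) :
    1 / √(r - ξ) * stdPhi (y / √(r - ξ)) ≤ 1 / √(r - ξ) ∧
    (√(2 * π))⁻¹ * Real.exp (-1) * (1 / √(r - ξ)) ≤ 1 / √(r - ξ) * stdPhi (y / √(r - ξ)) ∧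
    |-(y * y' / (r - ξ)) + y ^ 2 / (2 * (r - ξ) ^ 2)| ≤ 1 / (4 * (r - ξ)) := by
  have hτ : 0 < r - ξ := sub_pos.2 hr
  have hs : 0 < √(r - ξ) := Real.sqrt_pos.2 hτ
  have hsq : √(r - ξ) ^ 2 = r - ξ := Real.sq_sqrt hτ.le
  have hy2 : y ^ 2 ≤ L ^ 2 * (r - ξ) ^ 2 := by
    rw [← mul_pow]
    exact sq_le_sq' (by linarith [(abs_le.1 hy).1]) (abs_le.1 hy).2
  refine ⟨?_, ?_, ?_⟩
  · exact mul_le_of_le_one_right (by positivity) ((stdPhi_le _).trans inv_sqrt_two_pi_le_one)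
  · rw [mul_comm (1 / √(r - ξ)), stdPhi_eq, div_pow, hsq]
    refine mul_le_mul_of_nonneg_right (mul_le_mul_of_nonneg_left (Real.exp_le_exp.2 ?_)
      (by positivity)) (by positivity)
    have : y ^ 2 / (r - ξ) ≤ L ^ 2 * (r - ξ) := by
      rw [div_le_iff₀ hτ]
      linarith
    nlinarith [mul_nonneg (sq_nonneg L) hτ.le]
  · have e1 : |y * y' / (r - ξ)| ≤ L ^ 2 := by
      rw [abs_div, abs_of_pos hτ, div_le_iff₀ hτ, abs_mul]
      calc |y| * |y'| ≤ L * (r - ξ) * L :=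
            mul_le_mul hy hy' (abs_nonneg _) ((abs_nonneg _).trans hy)
        _ = _ := by ring
    have e2 : |y ^ 2 / (2 * (r - ξ) ^ 2)| ≤ L ^ 2 := by
      rw [abs_of_nonneg (by positivity), div_le_iff₀ (by positivity)]
      nlinarith [mul_nonneg (sq_nonneg L) (sq_nonneg (r - ξ))]
    have e3 : 2 * L ^ 2 ≤ 1 / (4 * (r - ξ)) := by
      rw [le_div_iff₀ (by positivity)]
      linarith
    calc _ ≤ |-(y * y' / (r - ξ))| + |y ^ 2 / (2 * (r - ξ) ^ 2)| := abs_add_le _ _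
      _ ≤ _ := by
        rw [abs_neg]
        linarith

/-- The slope of a weighted heat kernel along a Lipschitz curve is of order `-τ ^ (-3/2)`. -/
lemma weighted_kernel_slope_bounds {k τ b w w' m M K : ℝ} (hτ : 0 < τ) (hm : 0 < m)
    (hw : 1 / M ≤ w) (hM : 0 < M) (hwm : w ≤ 1 / m) (hw' : |w'| ≤ K) (hK : 8 * M * K * τ ≤ 1)
    (hb : |b| ≤ 1 / (4 * τ)) (hk : k ≤ 1 / √τ)
    (hk' : (√(2 * π))⁻¹ * Real.exp (-1) * (1 / √τ) ≤ k) :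
    -(1 / m / (τ * √τ)) ≤ 1 / 2 * (k * (-1 / (2 * τ) + b) * w + k * w') ∧
    1 / 2 * (k * (-1 / (2 * τ) + b) * w + k * w')
      ≤ -((√(2 * π))⁻¹ * Real.exp (-1) / (16 * M) / (τ * √τ)) := by
  have hs : 0 < √τ := Real.sqrt_pos.2 hτ
  have hk0 : 0 < k := lt_of_lt_of_le (by positivity) hk'
  have hw0 : 0 < w := lt_of_lt_of_le (by positivity) hw
  have hKM : K ≤ 1 / M * (1 / (8 * τ)) := by
    rw [div_mul_div_comm, le_div_iff₀ (by positivity)]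
    linarith
  obtain ⟨b1, b2⟩ := abs_le.1 hb
  obtain ⟨w1, w2⟩ := abs_le.1 hw'
  have e1 : 1 / (4 * τ) = 2 * (1 / (8 * τ)) := by field_simp; norm_num
  have e2 : -1 / (2 * τ) = -(4 * (1 / (8 * τ))) := by field_simp; norm_num
  have e3 : 0 < 1 / (8 * τ) := by positivity
  have hKw : 1 / M * (1 / (8 * τ)) ≤ w * (1 / (8 * τ)) := mul_le_mul_of_nonneg_right hw e3.le
  constructor
  · have h1 : -(7 * (1 / (8 * τ)) * w) ≤ (-1 / (2 * τ) + b) * w + w' := by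
      rw [e2]
      have := mul_le_mul_of_nonneg_right (show -(2 * (1 / (8 * τ))) ≤ b by linarith) hw0.le
      nlinarith
    have h2 : 1 / 2 * (7 * (1 / (8 * τ)) * w) * k ≤ 1 / m / (τ * √τ) := by
      calc 1 / 2 * (7 * (1 / (8 * τ)) * w) * k
          ≤ 1 / 2 * (7 * (1 / (8 * τ)) * (1 / m)) * (1 / √τ) := by gcongr
        _ ≤ 1 / 2 * (16 * (1 / (8 * τ)) * (1 / m)) * (1 / √τ) := by gcongr; norm_num
        _ = _ := by field_simp; norm_num
    nlinarith [mul_le_mul_of_nonneg_left h1 hk0.le]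
  · have h1 : (-1 / (2 * τ) + b) * w + w' ≤ -(1 / M * (1 / (8 * τ))) := by
      rw [e2]
      have := mul_le_mul_of_nonneg_right (show b ≤ 2 * (1 / (8 * τ)) by linarith) hw0.le
      nlinarith
    have h2 : (√(2 * π))⁻¹ * Real.exp (-1) / (16 * M) / (τ * √τ)
        ≤ 1 / 2 * (1 / M * (1 / (8 * τ))) * k := by
      calc _ = 1 / 2 * (1 / M * (1 / (8 * τ))) * ((√(2 * π))⁻¹ * Real.exp (-1) * (1 / √τ)) := by
            field_simp; norm_num
        _ ≤ _ := by gcongr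
    nlinarith [mul_le_mul_of_nonneg_left h1 hk0.le]

/-- Mean value estimate for a function whose slope is of order `-τ ^ (-3/2)`, up to a
perturbation with a square-root modulus of continuity. -/
lemma increment_bounds_of_slope {A A' G : ℝ → ℝ} {ξ a b c C c₁ c₂ : ℝ} (hξ : ξ < a) (hab : a < b)
    (hc : 0 ≤ c) (hC : 0 ≤ C) (hc₁ : 0 ≤ c₁) (hc₂ : 0 ≤ c₂)
    (hA : ∀ r ∈ Icc a b, HasDerivAt A (A' r) r)
    (hlow : ∀ r ∈ Icc a b, -(C / ((r - ξ) * √(r - ξ))) ≤ A' r)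
    (hup : ∀ r ∈ Icc a b, A' r ≤ -(2 * c / ((r - ξ) * √(r - ξ))))
    (hG : |G b - G a| ≤ c₁ * (b - a) + c₂ * (√(b - ξ) - √(a - ξ)))
    (h1 : b - ξ ≤ 1) (hsmall : (c₁ + c₂) * (b - ξ) ≤ c) :
    -((C + c) / ((a - ξ) * √(a - ξ)) * (b - a)) ≤ A b + G b - (A a + G a) ∧
      A b + G b - (A a + G a) ≤ -(c / ((b - ξ) * √(b - ξ)) * (b - a)) := by
  obtain ⟨g1, g2⟩ := abs_le.1 hG
  have hsqrt : ∀ r ∈ Icc a b, HasDerivAt (fun r => c₁ * r + c₂ * √(r - ξ))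
      (c₁ * 1 + c₂ * (1 / (2 * √(r - ξ)))) r := fun r hr =>
    ((hasDerivAt_id r).const_mul c₁).add
      ((((hasDerivAt_id r).sub_const ξ).sqrt (sub_pos.2 (hξ.trans_le hr.1)).ne').const_mul c₂)
  have hcorr : ∀ r ∈ Icc a b,
      c₁ * 1 + c₂ * (1 / (2 * √(r - ξ))) ≤ c / ((r - ξ) * √(r - ξ)) := by
    intro r hr
    have hτ : 0 < r - ξ := sub_pos.2 (hξ.trans_le hr.1)
    have hτb : r - ξ ≤ b - ξ := by linarith [hr.2]
    have hs : 0 < √(r - ξ) := Real.sqrt_pos.2 hτ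
    have hs1 : √(r - ξ) ≤ 1 := Real.sqrt_le_one.2 (hτb.trans h1)
    rw [le_div_iff₀ (by positivity)]
    have e : (c₁ * 1 + c₂ * (1 / (2 * √(r - ξ)))) * ((r - ξ) * √(r - ξ))
        = (c₁ * √(r - ξ) + c₂ / 2) * (r - ξ) := by field_simp
    rw [e]
    calc (c₁ * √(r - ξ) + c₂ / 2) * (r - ξ) ≤ (c₁ * 1 + c₂) * (b - ξ) := by
          gcongr
          linarith
      _ ≤ c := by linarith
  have hmono : ∀ {r r'}, ξ < r → r ≤ r' → (r - ξ) * √(r - ξ) ≤ (r' - ξ) * √(r' - ξ) := by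
    intro r r' hr hrr'
    have : 0 < r - ξ := sub_pos.2 hr
    have : 0 < r' - ξ := by linarith
    gcongr
  have hpos : ∀ {r}, ξ < r → 0 < (r - ξ) * √(r - ξ) := fun hr =>
    mul_pos (sub_pos.2 hr) (Real.sqrt_pos.2 (sub_pos.2 hr))
  constructor
  · obtain ⟨η, hη, he⟩ := exists_hasDerivAt_eq_slope
      (fun r => A r - (c₁ * r + c₂ * √(r - ξ))) _ hab
      (fun r hr => ((hA r hr).sub (hsqrt r hr)).continuousAt.continuousWithinAt)
      (fun r hr => (hA r (Ioo_subset_Icc_self hr)).sub (hsqrt r (Ioo_subset_Icc_self hr)))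
    rw [eq_div_iff (sub_pos.2 hab).ne'] at he
    have hη' := Ioo_subset_Icc_self hη
    have k1 : -((C + c) / ((η - ξ) * √(η - ξ)))
        ≤ A' η - (c₁ * 1 + c₂ * (1 / (2 * √(η - ξ)))) := by
      rw [add_div]
      linarith [hlow η hη', hcorr η hη']
    have k2 : (C + c) / ((η - ξ) * √(η - ξ)) ≤ (C + c) / ((a - ξ) * √(a - ξ)) :=
      div_le_div_of_nonneg_left (by positivity) (hpos hξ) (hmono hξ hη.1.le)
    have k3 := mul_le_mul_of_nonneg_right ((neg_le_neg k2).trans k1) (sub_pos.2 hab).le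
    rw [he] at k3
    linarith
  · obtain ⟨η, hη, he⟩ := exists_hasDerivAt_eq_slope
      (fun r => A r + (c₁ * r + c₂ * √(r - ξ))) _ hab
      (fun r hr => ((hA r hr).add (hsqrt r hr)).continuousAt.continuousWithinAt)
      (fun r hr => (hA r (Ioo_subset_Icc_self hr)).add (hsqrt r (Ioo_subset_Icc_self hr)))
    rw [eq_div_iff (sub_pos.2 hab).ne'] at he
    have hη' := Ioo_subset_Icc_self hη
    have k1 : A' η + (c₁ * 1 + c₂ * (1 / (2 * √(η - ξ)))) ≤ -(c / ((η - ξ) * √(η - ξ))) := by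
      have : 2 * c / ((η - ξ) * √(η - ξ))
        = c / ((η - ξ) * √(η - ξ)) + c / ((η - ξ) * √(η - ξ)) := by ring
      linarith [hup η hη', hcorr η hη']
    have k2 : c / ((b - ξ) * √(b - ξ)) ≤ c / ((η - ξ) * √(η - ξ)) :=
      div_le_div_of_nonneg_left hc (hpos (hξ.trans hη.1)) (hmono (hξ.trans hη.1) hη.2.le)
    have k3 := mul_le_mul_of_nonneg_right (k1.trans (neg_le_neg k2)) (sub_pos.2 hab).le
    rw [he] at k3
    linarith

lemma mul_sqrt_eq_rpow {τ : ℝ} (hτ : 0 < τ) (c : ℝ) :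
    c / (τ * √τ) = c * |τ| ^ (-(3 : ℝ) / 2) := by
  rw [abs_of_pos hτ, div_eq_mul_inv, neg_div, Real.rpow_neg hτ.le,
    show (3 : ℝ) / 2 = 1 + 1 / 2 by norm_num, Real.rpow_add hτ, Real.rpow_one, Real.sqrt_eq_rpow]

namespace HeatLevelCurve

variable {F f f' f'' q : ℝ → ℝ} {α M : ℝ}

lemma hasDerivAt_inv_density (H : HeatLevelCurve F f f' f'' q α M) {t m T : ℝ} (hm : 0 < m)
    (hD : ∀ t ∈ Icc 0 T, m ≤ gaussAvg f (q t) t) (ht : 0 < t) (htT : t ≤ T) :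
    HasDerivAt (fun r => (gaussAvg f (q r) r)⁻¹) (deriv (fun r => (gaussAvg f (q r) r)⁻¹) t) t ∧
      |deriv (fun r => (gaussAvg f (q r) r)⁻¹) t| ≤ (M / (2 * m) * M + 1 / 2 * M) / m ^ 2 := by
  have hpos := H.pos t ht.le
  have hmD := hD t ⟨ht.le, htT⟩
  have h := (H.hasDerivAt_density ht).inv hpos.ne'
  have h' : HasDerivAt (fun r => (gaussAvg f (q r) r)⁻¹) _ t := h
  refine ⟨h'.differentiableAt.hasDerivAt, ?_⟩
  rw [h'.deriv]
  have hM := H.M_nonneg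
  have a1 := abs_gaussAvg_le H.bound_f' (q t) t
  have a2 := abs_gaussAvg_le H.bound_f'' (q t) t
  rw [abs_div, abs_neg, abs_of_pos (pow_pos hpos 2)]
  gcongr
  refine (abs_add_le _ _).trans ?_
  rw [abs_mul, abs_mul, abs_div, abs_neg, abs_of_pos (a := 2 * _) (by linarith),
    abs_of_pos (by norm_num : (0 : ℝ) < 1 / 2)]
  gcongr

lemma abs_inv_density_sub_le (H : HeatLevelCurve F f f' f'' q α M) {t t' m T : ℝ} (hm : 0 < m)
    (hD : ∀ t ∈ Icc 0 T, m ≤ gaussAvg f (q t) t) (ht : 0 < t) (htt' : t ≤ t') (htT : t' ≤ T) :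
    |(gaussAvg f (q t') t')⁻¹ - (gaussAvg f (q t) t)⁻¹|
      ≤ (M / (2 * m) * M + 1 / 2 * M) / m ^ 2 * (t' - t) := by
  have := Convex.norm_image_sub_le_of_norm_hasDerivWithin_le (s := Icc t t')
    (f := fun r => (gaussAvg f (q r) r)⁻¹) (C := (M / (2 * m) * M + 1 / 2 * M) / m ^ 2)
    (fun r hr => (H.hasDerivAt_inv_density hm hD (ht.trans_le hr.1)
      (hr.2.trans htT)).1.hasDerivWithinAt)
    (fun r hr => (H.hasDerivAt_inv_density hm hD (ht.trans_le hr.1) (hr.2.trans htT)).2)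
    (convex_Icc t t') (left_mem_Icc.2 htt') (right_mem_Icc.2 htt')
  simpa [abs_of_nonneg (sub_nonneg.2 htt')] using this

/-- The quantile covariance attached to a level curve. -/
noncomputable def cov (F f q : ℝ → ℝ) (α s t : ℝ) : ℝ :=
  (jointLevel F q s t - α ^ 2) / (gaussAvg f (q s) s * gaussAvg f (q t) t)

lemma hasDerivAt_cov (H : HeatLevelCurve F f f' f'' q α M) {s t m T : ℝ} (hm : 0 < m)
    (hD : ∀ t ∈ Icc 0 T, m ≤ gaussAvg f (q t) t) (hs : 0 < s) (hst : s < t) (ht : t ≤ T) :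
    HasDerivAt (fun s => cov F f q α s t)
      (1 / 2 * (1 / √(t - s) * stdPhi ((q t - q s) / √(t - s)) * (gaussAvg f (q t) t)⁻¹)
        + deriv (fun r => (gaussAvg f (q r) r)⁻¹) s * (jointLevel F q s t - α ^ 2)
          * (gaussAvg f (q t) t)⁻¹) s := by
  have hW := (H.hasDerivAt_inv_density hm hD hs (hst.le.trans ht)).1
  have h := (((H.hasDerivAt_jointLevel hs hst).sub_const (α ^ 2)).mul hW).mul_const
    (gaussAvg f (q t) t)⁻¹
  have hne := (H.pos s hs.le).ne'
  refine (h.congr_deriv ?_).congr_of_eventuallyEq (Eventually.of_forall fun r => ?_)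
  · field_simp
  · simp only [cov, Pi.mul_apply]
    rw [div_eq_mul_inv, mul_inv]
    ring

lemma continuousOn_cov (H : HeatLevelCurve F f f' f'' q α M) {t : ℝ} (ht : 0 ≤ t) :
    ContinuousOn (fun s => cov F f q α s t) (Ici 0) :=
  ((H.continuousOn_jointLevel t).sub continuousOn_const).div
    (H.continuousOn_density.mul continuousOn_const)
    fun s hs => (mul_pos (H.pos s hs) (H.pos t ht)).ne'

/-- The remainder in the derivative of `cov` has a square-root modulus of continuity. -/
lemma abs_remainder_sub_le (H : HeatLevelCurve F f f' f'' q α M) {ξ a b m T K : ℝ} (hm : 0 < m)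
    (hα : |α| ≤ 1) (hD : ∀ t ∈ Icc 0 T, m ≤ gaussAvg f (q t) t)
    (hK : K = (M / (2 * m) * M + 1 / 2 * M) / m ^ 2)
    (hξ : 0 < ξ) (hξa : ξ < a) (hab : a ≤ b) (hb : b ≤ T) :
    |deriv (fun r => (gaussAvg f (q r) r)⁻¹) ξ * (jointLevel F q ξ b - α ^ 2)
          * (gaussAvg f (q b) b)⁻¹
        - deriv (fun r => (gaussAvg f (q r) r)⁻¹) ξ * (jointLevel F q ξ a - α ^ 2)
          * (gaussAvg f (q a) a)⁻¹|
      ≤ K * (M * (M / (2 * m)) / m + 2 * K) * (b - a)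
        + K * (M * (∫ z, |z| ∂stdGauss) / m) * (√(b - ξ) - √(a - ξ)) := by
  have hM := H.M_nonneg
  have hdW := (H.hasDerivAt_inv_density hm hD hξ (hξa.le.trans (hab.trans hb))).2
  have hW := H.abs_inv_density_sub_le hm hD (hξ.trans hξa) hab hb
  rw [← hK] at hdW hW
  have hJ := H.abs_jointLevel_sub_le (s := ξ) hab
  have hq := H.lipschitz_q hm hD (s := a) (t := b) ⟨(hξ.trans hξa).le, hab.trans hb⟩
    ⟨(hξ.trans hξa).le.trans hab, hb⟩
  rw [abs_of_nonneg (sub_nonneg.2 hab)] at hq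
  have hDb := hD b ⟨(hξ.trans hξa).le.trans hab, hb⟩
  have hN : |jointLevel F q ξ a - α ^ 2| ≤ 2 := by
    refine (abs_sub _ _).trans ?_
    have h1 := H.abs_jointLevel_le ξ a
    have h2 : |α ^ 2| ≤ 1 := by
      rw [abs_pow]
      exact pow_le_one₀ (abs_nonneg _) hα
    linarith
  have hWb : |(gaussAvg f (q b) b)⁻¹| ≤ 1 / m := by
    rw [abs_inv, abs_of_pos (hm.trans_le hDb), ← one_div]
    exact one_div_le_one_div_of_le hm hDb
  have hK0 : 0 ≤ K := (abs_nonneg _).trans hdW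
  have hE : 0 ≤ √(b - ξ) - √(a - ξ) := sub_nonneg.2 (Real.sqrt_le_sqrt (by linarith))
  have hE' : 0 ≤ ∫ z, |z| ∂stdGauss := integral_nonneg fun z => abs_nonneg z
  set W' := deriv (fun r => (gaussAvg f (q r) r)⁻¹) ξ
  set Wb := (gaussAvg f (q b) b)⁻¹
  set Wa := (gaussAvg f (q a) a)⁻¹
  set Jb := jointLevel F q ξ b
  set Ja := jointLevel F q ξ a
  set E := ∫ z, |z| ∂stdGauss
  have hJ' : |Jb - Ja| ≤ M * (M / (2 * m) * (b - a) + (√(b - ξ) - √(a - ξ)) * E) :=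
    hJ.trans (by gcongr)
  rw [show W' * (Jb - α ^ 2) * Wb - W' * (Ja - α ^ 2) * Wa
    = W' * ((Jb - Ja) * Wb + (Ja - α ^ 2) * (Wb - Wa)) by ring, abs_mul]
  calc |W'| * |(Jb - Ja) * Wb + (Ja - α ^ 2) * (Wb - Wa)|
      ≤ K * (M * (M / (2 * m) * (b - a) + (√(b - ξ) - √(a - ξ)) * E) * (1 / m)
          + 2 * (K * (b - a))) := by
        refine mul_le_mul hdW ((abs_add_le _ _).trans ?_) (abs_nonneg _) hK0
        rw [abs_mul, abs_mul]
        exact add_le_add (mul_le_mul hJ' hWb (abs_nonneg _) ((abs_nonneg _).trans hJ'))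
          (mul_le_mul hN hW (abs_nonneg _) (by norm_num))
    _ = _ := by ring

/-- Bounds for the increment over `[a, b]` of the derivative of `cov` in the earlier time. -/
lemma deriv_cov_increment_bounds (H : HeatLevelCurve F f f' f'' q α M) {T : ℝ} (hT : 0 ≤ T)
    (hα : |α| ≤ 1) :
    ∃ δ > 0, ∃ c > 0, ∃ C > 0, ∀ ξ a b, 0 < ξ → ξ < a → a < b → b ≤ T → b - ξ < δ →
      ∃ d d', HasDerivAt (fun s => cov F f q α s a) d ξ ∧
        HasDerivAt (fun s => cov F f q α s b) d' ξ ∧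
        -(C / ((a - ξ) * √(a - ξ)) * (b - a)) ≤ d' - d ∧
        d' - d ≤ -(c / ((b - ξ) * √(b - ξ)) * (b - a)) := by
  obtain ⟨m, hm, hD⟩ := H.exists_density_lower_bound T
  have hDM : ∀ t, gaussAvg f (q t) t ≤ M := fun t =>
    (le_abs_self _).trans (abs_gaussAvg_le H.bound_f _ _)
  have hM : 0 < M := (hm.trans_le (hD 0 ⟨le_rfl, hT⟩)).trans_le (hDM 0)
  obtain ⟨K, hK⟩ : ∃ K, K = (M / (2 * m) * M + 1 / 2 * M) / m ^ 2 := ⟨_, rfl⟩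
  have hK0 : 0 < K := hK ▸ by positivity
  set L := M / (2 * m) with hL
  have hL0 : 0 < L := by positivity
  set E := ∫ z, |z| ∂stdGauss with hE
  have hE0 : 0 ≤ E := integral_nonneg fun z => abs_nonneg z
  set c := (√(2 * π))⁻¹ * Real.exp (-1) / (16 * M) / 2 with hc
  have hc0 : 0 < c := by positivity
  set c₁ := K * (M * L / m + 2 * K) with hc₁
  have hc₁0 : 0 < c₁ := by positivity
  set c₂ := K * (M * E / m) with hc₂
  have hc₂0 : 0 ≤ c₂ := by positivity
  refine ⟨min (min 1 (1 / (8 * L ^ 2))) (min (1 / (8 * M * K)) (c / (c₁ + c₂))), by positivity,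
    c, hc0, 1 / m + c, by positivity, fun ξ a b hξ hξa hab hb hδ => ?_⟩
  obtain ⟨⟨h1, h2⟩, h3, h4⟩ : (b - ξ < 1 ∧ b - ξ < 1 / (8 * L ^ 2)) ∧
      b - ξ < 1 / (8 * M * K) ∧ b - ξ < c / (c₁ + c₂) := by
    simpa only [lt_min_iff] using hδ
  rw [lt_div_iff₀ (by positivity)] at h2 h3 h4
  refine ⟨_, _, H.hasDerivAt_cov hm hD hξ hξa (hab.le.trans hb),
    H.hasDerivAt_cov hm hD hξ (hξa.trans hab) hb, ?_⟩
  have hG := H.abs_remainder_sub_le hm hα hD hK hξ hξa hab.le hb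
  have key : ∀ r ∈ Icc a b, ∃ A',
      HasDerivAt (fun r => 1 / 2 * (1 / √(r - ξ) * stdPhi ((q r - q ξ) / √(r - ξ))
        * (gaussAvg f (q r) r)⁻¹)) A' r ∧ -(1 / m / ((r - ξ) * √(r - ξ))) ≤ A' ∧
      A' ≤ -(2 * c / ((r - ξ) * √(r - ξ))) := by
    intro r hr
    have hξr : ξ < r := hξa.trans_le hr.1
    have hr0 : 0 < r := hξ.trans hξr
    have hrT : r ≤ T := hr.2.trans hb
    have hτ : 0 < r - ξ := sub_pos.2 hξr
    have hτb : r - ξ ≤ b - ξ := by linarith [hr.2]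
    obtain ⟨w1, w2⟩ := H.hasDerivAt_inv_density hm hD hr0 hrT
    have hDr := hD r ⟨hr0.le, hrT⟩
    have hq' : |-(gaussAvg f' (q r) r) / (2 * gaussAvg f (q r) r)| ≤ L := by
      have := abs_gaussAvg_le H.bound_f' (q r) r
      rw [abs_div, abs_neg, abs_of_pos (a := 2 * _) (by linarith), hL]
      gcongr
    have hq := H.lipschitz_q hm hD (s := ξ) (t := r) ⟨hξ.le, hξr.le.trans hrT⟩ ⟨hr0.le, hrT⟩
    rw [abs_of_pos hτ] at hq
    obtain ⟨k1, k2, k3⟩ := kernel_bounds hξr hq hq' (by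
      have : 8 * L ^ 2 * (r - ξ) ≤ 8 * L ^ 2 * (b - ξ) := by gcongr
      linarith)
    rw [← hK] at w2
    have hslope := weighted_kernel_slope_bounds hτ hm (w := (gaussAvg f (q r) r)⁻¹) (M := M)
      (by rw [one_div]; exact inv_anti₀ (hm.trans_le hDr) (hDM r)) hM
      (by rw [one_div]; exact inv_anti₀ hm hDr) w2 (by
        have : 8 * M * K * (r - ξ) ≤ 8 * M * K * (b - ξ) := by gcongr
        linarith) k3 k1 k2
    have hder := ((hasDerivAt_kernel hξr ((H.hasDerivAt_q hr0).sub_const (q ξ))).mul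
      w1).const_mul (1 / 2)
    refine ⟨_, hder, ?_, ?_⟩
    · refine hslope.1.trans_eq ?_
      ring
    · rw [show 2 * c = (√(2 * π))⁻¹ * Real.exp (-1) / (16 * M) by rw [hc]; ring]
      refine le_trans (le_of_eq ?_) hslope.2
      ring
  choose! A' hA' hlow hup using key
  exact increment_bounds_of_slope
    (G := fun r => deriv (fun r => (gaussAvg f (q r) r)⁻¹) ξ * (jointLevel F q ξ r - α ^ 2)
      * (gaussAvg f (q r) r)⁻¹) hξa hab hc0.le (by positivity) hc₁0.le hc₂0 hA' hlow hup
    hG h1.le (by linarith)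

/-- Increments of `cov` over disjoint nearby time intervals are negatively correlated. -/
lemma cov_increment_bounds (H : HeatLevelCurve F f f' f'' q α M) {T : ℝ} (hT : 0 < T)
    (hα : |α| ≤ 1) :
    ∃ δ > 0, ∃ C₁ > 0, ∃ C₂ > 0, ∀ s t Δs Δt : ℝ,
      0 ≤ s → s < t → t ≤ T → 0 < Δs → 0 ≤ s - Δs → 0 < Δt →
      t - s < δ → Δs < δ → Δt < δ →
      -(C₂ * |t - s| ^ (-(3 : ℝ) / 2) * Δs * Δt)
          ≤ cov F f q α s (t + Δt) - cov F f q α s t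
            - cov F f q α (s - Δs) (t + Δt) + cov F f q α (s - Δs) t ∧
        cov F f q α s (t + Δt) - cov F f q α s t
            - cov F f q α (s - Δs) (t + Δt) + cov F f q α (s - Δs) t
          ≤ -(C₁ * |t + Δt - (s - Δs)| ^ (-(3 : ℝ) / 2) * Δs * Δt) := by
  obtain ⟨δ, hδ, c, hc, C, hC, h⟩ := H.deriv_cov_increment_bounds (T := T + 1) (by linarith) hα
  refine ⟨min 1 (δ / 3), by positivity, c, hc, C, hC, ?_⟩
  intro s t Δs Δt hs hst ht hΔs hsΔ hΔt h1 h2 h3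
  obtain ⟨-, h1⟩ := lt_min_iff.1 h1
  obtain ⟨-, h2⟩ := lt_min_iff.1 h2
  obtain ⟨h4, h3⟩ := lt_min_iff.1 h3
  have key : ∀ ξ ∈ Ioo (s - Δs) s, ∃ e, HasDerivAt
      (fun r => cov F f q α r (t + Δt) - cov F f q α r t) e ξ ∧
      -(C * |t - s| ^ (-(3 : ℝ) / 2) * Δt) ≤ e ∧
      e ≤ -(c * |t + Δt - (s - Δs)| ^ (-(3 : ℝ) / 2) * Δt) := by
    intro ξ hξ
    obtain ⟨d, d', hd, hd', hlow, hup⟩ := h ξ t (t + Δt) (hsΔ.trans_lt hξ.1) (hξ.2.trans hst)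
      (by linarith) (by linarith) (by linarith [hξ.1])
    refine ⟨d' - d, hd'.sub hd, le_trans ?_ hlow, hup.trans ?_⟩
    · rw [← mul_sqrt_eq_rpow (sub_pos.2 hst), add_sub_cancel_left]
      have : 0 < t - s := sub_pos.2 hst
      have : t - s ≤ t - ξ := by linarith [hξ.2]
      have : 0 < t - ξ := by linarith
      gcongr
    · rw [← mul_sqrt_eq_rpow (by linarith), add_sub_cancel_left]
      have : 0 < t + Δt - ξ := by linarith [hξ.2]
      have : t + Δt - ξ ≤ t + Δt - (s - Δs) := by linarith [hξ.1]
      have : 0 < t + Δt - (s - Δs) := by linarith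
      gcongr
  choose! e he hlow hup using key
  obtain ⟨ξ, hξ, hslope⟩ := exists_hasDerivAt_eq_slope
    (fun r => cov F f q α r (t + Δt) - cov F f q α r t) e (show s - Δs < s by linarith)
    (((H.continuousOn_cov (by linarith)).sub (H.continuousOn_cov (by linarith))).mono
      fun r hr => hsΔ.trans hr.1) he
  rw [sub_sub_cancel, eq_div_iff hΔs.ne'] at hslope
  have k1 := mul_le_mul_of_nonneg_right (hlow ξ hξ) hΔs.le
  have k2 := mul_le_mul_of_nonneg_right (hup ξ hξ) hΔs.le
  rw [hslope] at k1 k2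
  constructor <;> linarith

end HeatLevelCurve

lemma gaussAvg_pos {g : ℝ → ℝ} {M t x : ℝ} (hg : Continuous g) (hM : ∀ x, |g x| ≤ M)
    (h0 : ∀ x, 0 ≤ g x) (hx : 0 < g x) (ht : 0 < t) (y : ℝ) : 0 < gaussAvg g y t := by
  have hi := (integrable_stdGauss_iff _).1 (integrable_gaussAvg hg hM y t)
  have hs : √t ≠ 0 := (Real.sqrt_pos.2 ht).ne'
  rw [gaussAvg, integral_stdGauss]
  refine integral_pos_of_integrable_nonneg_nonzero (x := (x - y) / √t) ?_ hi ?_ ?_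
  · have : Continuous stdPhi := continuous_iff_continuousAt.2 fun z =>
      (hasDerivAt_stdPhi z).continuousAt
    fun_prop
  · exact fun z => mul_nonneg (h0 _) (ProbabilityTheory.gaussianPDFReal_nonneg 0 1 z)
  · rw [mul_div_cancel₀ _ hs, add_sub_cancel]
    exact (mul_pos hx (ProbabilityTheory.gaussianPDFReal_pos 0 1 _ one_ne_zero)).ne'

lemma hasDerivAt_integral_Iic {g : ℝ → ℝ} (hc : Continuous g) (hg : Integrable g) (x : ℝ) :
    HasDerivAt (fun x => ∫ y in Iic x, g y) (g x) x := by
  have h := (intervalIntegral.integral_hasDerivAt_right (hc.intervalIntegrable 0 x)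
    (hc.stronglyMeasurableAtFilter volume (𝓝 x)) hc.continuousAt).const_add (∫ y in Iic 0, g y)
  refine h.congr_of_eventuallyEq (Eventually.of_forall fun r => ?_)
  have := intervalIntegral.integral_Iic_sub_Iic (a := 0) (b := r) hg.integrableOn hg.integrableOn
  simp only
  linarith

lemma SchwartzMap.exists_abs_le (g : SchwartzMap ℝ ℝ) : ∃ M, ∀ x, |g x| ≤ M := by
  obtain ⟨M, -, hM⟩ := g.decay 0 0
  exact ⟨M, fun x => by simpa using hM x⟩

/-- The distribution function of a Schwartz density has a quantile curve under the heat flow. -/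
lemma exists_heatLevelCurve (f : SchwartzMap ℝ ℝ) (hf_nonneg : ∀ x, 0 ≤ f x)
    (hf_prob : ∫ x : ℝ, f x = 1) (α : ℝ) (q : ℝ → ℝ)
    (hq : ∀ t, 0 ≤ t → ∫ x in Set.Iic (q t), udens (⇑f) x t = α)
    (hq_unique : ∀ t, 0 ≤ t → ∀ r : ℝ, (∫ x in Set.Iic r, udens (⇑f) x t = α) → r = q t)
    (hfq0 : 0 < f (q 0)) :
    ∃ f' f'' : ℝ → ℝ, ∃ M, HeatLevelCurve (fun x => ∫ y in Iic x, f y) f f' f'' q α M := by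
  obtain ⟨M₀, h0⟩ := f.exists_abs_le
  obtain ⟨M₁, h1⟩ := (SchwartzMap.derivCLM ℝ ℝ f).exists_abs_le
  obtain ⟨M₂, h2⟩ := (SchwartzMap.derivCLM ℝ ℝ (SchwartzMap.derivCLM ℝ ℝ f)).exists_abs_le
  have hd : ∀ (g : SchwartzMap ℝ ℝ) x, HasDerivAt g (SchwartzMap.derivCLM ℝ ℝ g x) x :=
    fun g x => g.differentiableAt.hasDerivAt
  have hlevel : ∀ t, 0 ≤ t → ∀ r, ∫ x in Iic r, udens (⇑f) x t
      = gaussAvg (fun x => ∫ y in Iic x, f y) r t := fun t ht r => by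
    simp only [udens_eq_gaussAvg f.continuous _ ht]
    exact setIntegral_Iic_gaussAvg f.continuous f.integrable r t
  refine ⟨_, _, max M₀ (max M₁ M₂), ?_, hd _, hd _, SchwartzMap.continuous _, hf_nonneg,
    fun x => ?_, fun x => (h0 x).trans (le_max_left _ _),
    fun x => (h1 x).trans ((le_max_left _ _).trans (le_max_right _ _)),
    fun x => (h2 x).trans ((le_max_right _ _).trans (le_max_right _ _)), ?_, ?_, ?_⟩
  · exact hasDerivAt_integral_Iic f.continuous f.integrable
  · rw [abs_of_nonneg (integral_nonneg hf_nonneg), ← hf_prob]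
    exact setIntegral_le_integral f.integrable (ae_of_all _ hf_nonneg)
  · exact fun t ht => (hlevel t ht _).symm.trans (hq t ht)
  · exact fun t ht r hr => hq_unique t ht r ((hlevel t ht r).trans hr)
  · intro t ht
    rcases ht.eq_or_lt with rfl | ht
    · rwa [gaussAvg_zero]
    · exact gaussAvg_pos f.continuous h0 hf_nonneg hfq0 ht _

theorem rho_disjoint_increment_covariance_bound
    {Ω : Type*} [MeasurableSpace Ω] (P : Measure Ω) [IsProbabilityMeasure P]
    (f : SchwartzMap ℝ ℝ) (hf_nonneg : ∀ x, 0 ≤ f x) (hf_prob : ∫ x : ℝ, f x = 1)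
    (α : ℝ) (hα : α ∈ Set.Ioo (0 : ℝ) 1)
    (q : ℝ → ℝ)
    (hq : ∀ t, 0 ≤ t → ∫ x in Set.Iic (q t), udens (⇑f) x t = α)
    (hq_unique : ∀ t, 0 ≤ t → ∀ r : ℝ, (∫ x in Set.Iic r, udens (⇑f) x t = α) → r = q t)
    (hfq0 : 0 < f (q 0))
    (B : ℝ → Ω → ℝ) (hB_meas : ∀ t, Measurable (B t))
    (hBmarg : ∀ t, 0 ≤ t → ∀ a : ℝ,
      (P {ω | B t ω ≤ a}).toReal = ∫ x in Set.Iic a, udens (⇑f) x t)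
    (hBjoint : ∀ s t : ℝ, 0 ≤ s → s < t → ∀ a b : ℝ,
      (P {ω | B s ω ≤ a ∧ B t ω ≤ b}).toReal
        = ∫ x in Set.Iic a, (∫ y in Set.Iic b, heatKernel (t - s) x y) * udens (⇑f) x s)
    (T : ℝ) (hT : 0 < T) :
    ∃ δ > (0 : ℝ), ∃ C₁ > (0 : ℝ), ∃ C₂ > (0 : ℝ), ∀ s t Δs Δt : ℝ,
      0 ≤ s → s < t → t ≤ T → 0 < Δs → 0 ≤ s - Δs → 0 < Δt →
      t - s < δ → Δs < δ → Δt < δ →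
      -(C₂ * |t - s| ^ (-(3 : ℝ) / 2) * Δs * Δt)
          ≤ rho P B (⇑f) q α s (t + Δt) - rho P B (⇑f) q α s t
            - rho P B (⇑f) q α (s - Δs) (t + Δt) + rho P B (⇑f) q α (s - Δs) t ∧
        rho P B (⇑f) q α s (t + Δt) - rho P B (⇑f) q α s t
            - rho P B (⇑f) q α (s - Δs) (t + Δt) + rho P B (⇑f) q α (s - Δs) t
          ≤ -(C₁ * |t + Δt - (s - Δs)| ^ (-(3 : ℝ) / 2) * Δs * Δt) := by
  obtain ⟨f', f'', M, H⟩ := exists_heatLevelCurve f hf_nonneg hf_prob α q hq hq_unique hfq0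
  have hrho : ∀ s t, 0 ≤ s → s < t → rho P B f q α s t
      = HeatLevelCurve.cov (fun x => ∫ y in Iic x, f y) f q α s t := by
    intro s t hs hst
    rw [rho, HeatLevelCurve.cov, hBjoint s t hs hst]
    simp only [udens_eq_gaussAvg f.continuous _ hs,
      udens_eq_gaussAvg f.continuous _ (hs.trans hst.le)]
    rw [setIntegral_heatKernel_mul (integrable_gaussAvg_space f.continuous f.integrable s)
      (sub_pos.2 hst)]
    simp only [setIntegral_Iic_gaussAvg f.continuous f.integrable]
    rfl
  obtain ⟨δ, hδ, C₁, hC₁, C₂, hC₂, h⟩ := H.cov_increment_bounds hT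
    (abs_le.2 ⟨by linarith [hα.1], hα.2.le⟩)
  refine ⟨δ, hδ, C₁, hC₁, C₂, hC₂, fun s t Δs Δt hs hst ht hΔs hsΔ hΔt h1 h2 h3 => ?_⟩
  rw [hrho s (t + Δt) hs (by linarith), hrho s t hs hst,
    hrho (s - Δs) (t + Δt) hsΔ (by linarith), hrho (s - Δs) t hsΔ (by linarith)]
  exact h s t Δs Δt hs hst ht hΔs hsΔ hΔt h1 h2 h3
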